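/- arXiv:2605.14195 — 2 statements merged into one kernel-verified Lean document; each statement's English description precedes it below -/
import Mathlib

section
/- Fix real numbers y₁ ≥ 0, y₂ ≥ 0, w > 0 and R ≥ 0. Define G : [0, R] → ℝ by G(a) = ∑_{n=0}^{∞} (exp(−a)·aⁿ/n!)·max(y₁ + w·n − 1, 0) + ∑_{n=0}^{∞} (exp(−(R−a))·(R−a)ⁿ/n!)·max(y₂ + w·n − 1, 0). Then G is convex on [0, R]; consequently, for every closed subinterval [ℓ, u] ⊆ [0, R], the maximum of G over [ℓ, u] equals max(G(ℓ), G(u)). -/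
/-- The expectation of `h N` for a Poisson variable `N` of mean `a`. -/
noncomputable def poissonMean (h : ℕ → ℝ) (a : ℝ) : ℝ :=
  ∑' n : ℕ, (Real.exp (-a) * a ^ n / (n.factorial : ℝ)) * h n

theorem summable_pow_div_factorial_mul {h : ℕ → ℝ} {C : ℝ} (hh : ∀ n, |h n| ≤ C * 2 ^ n) (a : ℝ) :
    Summable fun n : ℕ => a ^ n / (n.factorial : ℝ) * h n := by
  refine Summable.of_norm_bounded
    ((Real.summable_pow_div_factorial (|a| * 2)).mul_left C) fun n => ?_
  rw [Real.norm_eq_abs, abs_mul, abs_div, abs_pow, Nat.abs_cast, mul_pow]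
  calc |a| ^ n / (n.factorial : ℝ) * |h n|
      ≤ |a| ^ n / (n.factorial : ℝ) * (C * 2 ^ n) := by gcongr; exact hh n
    _ = C * (|a| ^ n * 2 ^ n / (n.factorial : ℝ)) := by ring

theorem abs_succ_le_of_abs_le {h : ℕ → ℝ} {C : ℝ} (hh : ∀ n, |h n| ≤ C * 2 ^ n) (n : ℕ) :
    |h (n + 1)| ≤ 2 * C * 2 ^ n :=
  (hh (n + 1)).trans_eq (by ring)

theorem succ_mul_pow_div_factorial (a : ℝ) (n : ℕ) :
    ((n + 1 : ℕ) : ℝ) * a ^ n / ((n + 1).factorial : ℝ) = a ^ n / (n.factorial : ℝ) := by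
  rw [Nat.factorial_succ, Nat.cast_mul]
  have : ((n + 1 : ℕ) : ℝ) ≠ 0 := by positivity
  field_simp

theorem hasDerivAt_tsum_pow_div_factorial_mul {h : ℕ → ℝ} {C : ℝ}
    (hh : ∀ n, |h n| ≤ C * 2 ^ n) (a : ℝ) :
    HasDerivAt (fun x => ∑' n : ℕ, x ^ n / (n.factorial : ℝ) * h n)
      (∑' n : ℕ, a ^ n / (n.factorial : ℝ) * h (n + 1)) a := by
  have hshift := abs_succ_le_of_abs_le hh
  have hsum (r : ℝ) {k : ℕ → ℝ} {D : ℝ} (hk : ∀ n, |k n| ≤ D * 2 ^ n) :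
      Summable fun n : ℕ => (n : ℝ) * r ^ (n - 1) / (n.factorial : ℝ) * k n := by
    rw [← summable_nat_add_iff 1]
    simpa only [Nat.add_sub_cancel, succ_mul_pow_div_factorial] using
      summable_pow_div_factorial_mul (abs_succ_le_of_abs_le hk) r
  have hkey := hasDerivAt_tsum_of_isPreconnected
    (g := fun (n : ℕ) x => x ^ n / (n.factorial : ℝ) * h n)
    (g' := fun (n : ℕ) x => (n : ℝ) * x ^ (n - 1) / (n.factorial : ℝ) * h n)
    (hsum (|a| + 1) (k := fun n => |h n|) (by simpa using hh)) (t := Metric.ball 0 (|a| + 1))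
    (y₀ := a) (y := a) Metric.isOpen_ball (convex_ball _ _).isPreconnected
    (fun n x _ => ((hasDerivAt_pow n x).div_const _).mul_const _)
    (fun n x hx => by
      rw [mem_ball_zero_iff, Real.norm_eq_abs] at hx
      rw [Real.norm_eq_abs, abs_mul, abs_div, abs_mul, abs_pow, Nat.abs_cast, Nat.abs_cast]
      gcongr)
    (by simp) (summable_pow_div_factorial_mul hh a) (by simp)
  rwa [(hsum a hh).tsum_eq_zero_add, Nat.cast_zero, zero_mul, zero_div, zero_mul, zero_add,
    tsum_congr fun n => by rw [Nat.add_sub_cancel, succ_mul_pow_div_factorial]] at hkey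

theorem poissonMean_eq_exp_mul (h : ℕ → ℝ) (a : ℝ) :
    poissonMean h a = Real.exp (-a) * ∑' n : ℕ, a ^ n / (n.factorial : ℝ) * h n := by
  rw [poissonMean, ← tsum_mul_left]
  exact tsum_congr fun n => by ring

theorem hasDerivAt_poissonMean {h : ℕ → ℝ} {C : ℝ} (hh : ∀ n, |h n| ≤ C * 2 ^ n) (a : ℝ) :
    HasDerivAt (poissonMean h) (poissonMean (fun n => h (n + 1) - h n) a) a := by
  have hexp : HasDerivAt (fun x : ℝ => Real.exp (-x)) (-Real.exp (-a)) a := by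
    simpa using (hasDerivAt_neg a).exp
  rw [funext (poissonMean_eq_exp_mul h), poissonMean_eq_exp_mul]
  refine (hexp.mul (hasDerivAt_tsum_pow_div_factorial_mul hh a)).congr_deriv ?_
  simp only [mul_sub]
  rw [(summable_pow_div_factorial_mul (abs_succ_le_of_abs_le hh) a).tsum_sub
    (summable_pow_div_factorial_mul hh a)]
  ring

theorem poissonMean_nonneg {h : ℕ → ℝ} (hh : ∀ n, 0 ≤ h n) {a : ℝ} (ha : 0 ≤ a) :
    0 ≤ poissonMean h a :=
  tsum_nonneg fun n => mul_nonneg (by positivity) (hh n)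

/-- The Poisson mean of a discretely convex function is convex in the parameter. -/
theorem convexOn_poissonMean {h : ℕ → ℝ} {C : ℝ} (hh : ∀ n, |h n| ≤ C * 2 ^ n)
    (hconv : ∀ n, 0 ≤ h (n + 2) - h (n + 1) - (h (n + 1) - h n)) :
    ConvexOn ℝ (Set.Ici 0) (poissonMean h) := by
  have hdiff (n : ℕ) : |h (n + 1) - h n| ≤ 3 * C * 2 ^ n := by
    refine (abs_sub _ _).trans ?_
    linarith [abs_succ_le_of_abs_le hh n, hh n]
  exact convexOn_of_hasDerivWithinAt2_nonneg (convex_Ici 0)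
    (fun x _ => (hasDerivAt_poissonMean hh x).continuousAt.continuousWithinAt)
    (fun x _ => (hasDerivAt_poissonMean hh x).hasDerivWithinAt)
    (fun x _ => (hasDerivAt_poissonMean hdiff x).hasDerivWithinAt)
    (fun x hx => poissonMean_nonneg hconv (interior_subset hx))

theorem convexOn_poissonMean_excess {y w : ℝ} (hy : 0 ≤ y) (hw : 0 ≤ w) :
    ConvexOn ℝ (Set.Ici 0) (poissonMean fun n => max (y + w * n - 1) 0) := by
  refine convexOn_poissonMean (C := y + w) (fun n => ?_) (fun n => ?_)
  · have hn : (n : ℝ) ≤ 2 ^ n := by exact_mod_cast n.lt_two_pow_self.le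
    have hone : (1 : ℝ) ≤ 2 ^ n := one_le_pow₀ (by norm_num)
    rw [abs_of_nonneg (le_max_right _ _)]
    refine max_le ?_ (by positivity)
    nlinarith [mul_le_mul_of_nonneg_left hn hw, mul_le_mul_of_nonneg_left hone hy]
  · push_cast
    grind

theorem stmt_6 (y₁ y₂ w R : ℝ) (hy₁ : 0 ≤ y₁) (hy₂ : 0 ≤ y₂) (hw : 0 < w) (hR : 0 ≤ R)
    (G : ℝ → ℝ)
    (hG : ∀ a : ℝ, G a =
      (∑' n : ℕ, (Real.exp (-a) * a ^ n / (n.factorial : ℝ)) * max (y₁ + w * n - 1) 0) +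
      (∑' n : ℕ, (Real.exp (-(R - a)) * (R - a) ^ n / (n.factorial : ℝ)) * max (y₂ + w * n - 1) 0)) :
    ConvexOn ℝ (Set.Icc 0 R) G ∧
    ∀ ℓ u : ℝ, 0 ≤ ℓ → ℓ ≤ u → u ≤ R →
      IsGreatest (G '' Set.Icc ℓ u) (max (G ℓ) (G u)) := by
  have hG_eq : G = fun a => poissonMean (fun n => max (y₁ + w * n - 1) 0) a +
      poissonMean (fun n => max (y₂ + w * n - 1) 0) (R - a) := funext hG
  have hconv : ConvexOn ℝ (Set.Icc 0 R) G := by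
    rw [hG_eq]
    refine ((convexOn_poissonMean_excess hy₁ hw.le).subset Set.Icc_subset_Ici_self
      (convex_Icc 0 R)).add ?_
    refine ((convexOn_poissonMean_excess hy₂ hw.le).comp_affineMap
      (AffineMap.lineMap R (R - 1))).subset (fun x hx => ?_) (convex_Icc 0 R) |>.congr
        fun x _ => ?_
    · simp [AffineMap.lineMap_apply, hx.2]
    · simp [AffineMap.lineMap_apply, sub_eq_neg_add]
  refine ⟨hconv, fun ℓ u hℓ hℓu hu => ⟨?_, ?_⟩⟩
  · rcases max_choice (G ℓ) (G u) with h | h <;> rw [h]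
    · exact Set.mem_image_of_mem G (Set.left_mem_Icc.2 hℓu)
    · exact Set.mem_image_of_mem G (Set.right_mem_Icc.2 hℓu)
  · rintro _ ⟨x, hx, rfl⟩
    exact hconv.le_max_of_mem_Icc ⟨hℓ, hℓu.trans hu⟩ ⟨hℓ.trans hℓu, hu⟩ hx
end

section
/- Fix a real number τ with 0 < τ < 1, a natural number m ≥ 1, and real numbers η₁, …, η_m each in [0, 1] with average η = (1/m)·∑_{i=1}^m ηᵢ. Define B₁(x) = (1/2)·√(x + τ·(1 − x)) and B₂(x) = exp(−x)·(x + (√τ/2)·√(1 − x)), and U(x) = min(B₁(x), B₂(x)). Then ∑_{i=1}^m U(ηᵢ) ≤ m·U(η). -/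
/-- On the positive reals, `s + 1/s - 1/(4s³) ≤ 2(1 + s²)`, also after scaling by `c ∈ [0, 1/2]`. -/
theorem mul_add_inv_sub_le {c s : ℝ} (hc0 : 0 ≤ c) (hc : c ≤ 1 / 2) (hs : 0 < s) :
    c * (s + 1 / s - 1 / (4 * s ^ 3)) ≤ 1 + s ^ 2 := by
  have key : s + 1 / s - 1 / (4 * s ^ 3) ≤ 2 * (1 + s ^ 2) := by
    have h : 2 * (1 + s ^ 2) - (s + 1 / s - 1 / (4 * s ^ 3)) =
        ((1 - 2 * s ^ 2) ^ 2 + 8 * s ^ 3 * ((s - 1 / 2) ^ 2 + 3 / 4)) / (4 * s ^ 3) := by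
      field_simp
      ring
    have : 0 ≤ 2 * (1 + s ^ 2) - (s + 1 / s - 1 / (4 * s ^ 3)) := by
      rw [h]
      positivity
    linarith
  calc c * (s + 1 / s - 1 / (4 * s ^ 3)) ≤ c * (2 * (1 + s ^ 2)) :=
        mul_le_mul_of_nonneg_left key hc0
    _ ≤ 1 + s ^ 2 := by nlinarith [sq_nonneg s]

theorem concaveOn_exp_neg_mul_add_sqrt {c : ℝ} (hc0 : 0 ≤ c) (hc : c ≤ 1 / 2) :
    ConcaveOn ℝ (Set.Icc 0 1) fun x : ℝ => Real.exp (-x) * (x + c * Real.sqrt (1 - x)) := by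
  have hexp (x : ℝ) : HasDerivAt (fun x : ℝ => Real.exp (-x)) (-Real.exp (-x)) x := by
    simpa using (hasDerivAt_neg x).exp
  have hsqrt {x : ℝ} (hx : x < 1) :
      HasDerivAt (fun x : ℝ => Real.sqrt (1 - x)) (-1 / (2 * Real.sqrt (1 - x))) x :=
    ((hasDerivAt_id x).const_sub 1).sqrt (sub_pos.2 hx).ne'
  refine concaveOn_of_hasDerivWithinAt2_nonpos (convex_Icc 0 1)
    (f' := fun x => Real.exp (-x) *
      (1 - x - c * (Real.sqrt (1 - x) + 1 / 2 * (Real.sqrt (1 - x))⁻¹)))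
    (f'' := fun x => Real.exp (-x) * (x - 2 + c * (Real.sqrt (1 - x) + 1 / Real.sqrt (1 - x)
      - 1 / (4 * Real.sqrt (1 - x) ^ 3)))) (by fun_prop) ?_ ?_ ?_ <;>
    rw [interior_Icc] <;> rintro x ⟨-, hx⟩ <;>
    have hs : 0 < Real.sqrt (1 - x) := Real.sqrt_pos.2 (sub_pos.2 hx)
  · refine (((hexp x).mul ((hasDerivAt_id x).add
      ((hsqrt hx).const_mul c))).congr_deriv ?_).hasDerivWithinAt
    simp only [id, Pi.add_apply]
    field_simp
    ring
  · refine (((hexp x).mul (((hasDerivAt_id x).const_sub 1).sub (((hsqrt hx).add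
      (((hsqrt hx).inv hs.ne').const_mul (1 / 2))).const_mul c))).congr_deriv ?_).hasDerivWithinAt
    simp only [id, Pi.add_apply, Pi.sub_apply, Pi.inv_apply]
    field_simp
    ring
  · have h := mul_add_inv_sub_le hc0 hc hs
    have hsq : Real.sqrt (1 - x) ^ 2 = 1 - x := Real.sq_sqrt (sub_pos.2 hx).le
    exact mul_nonpos_of_nonneg_of_nonpos (Real.exp_pos _).le (by linarith)

theorem concaveOn_half_mul_sqrt {τ : ℝ} (hτ : 0 ≤ τ) :
    ConcaveOn ℝ (Set.Icc 0 1) fun x : ℝ => (1 / 2) * Real.sqrt (x + τ * (1 - x)) := by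
  refine ConcaveOn.smul (c := (1 / 2 : ℝ)) (by norm_num)
    ⟨convex_Icc 0 1, fun x hx y hy a b ha hb hab => ?_⟩
  have hmem {z : ℝ} (hz : z ∈ Set.Icc (0 : ℝ) 1) : z + τ * (1 - z) ∈ Set.Ici (0 : ℝ) :=
    add_nonneg hz.1 (mul_nonneg hτ (sub_nonneg.2 hz.2))
  convert Real.strictConcaveOn_sqrt.concaveOn.2 (hmem hx) (hmem hy) ha hb hab using 2
  simp only [smul_eq_mul]
  linear_combination -τ * hab

theorem stmt_15 (τ : ℝ) (hτ0 : 0 < τ) (hτ1 : τ < 1)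
    (m : ℕ) (hm : 1 ≤ m) (η : Fin m → ℝ) (hη : ∀ i, η i ∈ Set.Icc (0 : ℝ) 1)
    (ηbar : ℝ) (hηbar : ηbar = (1 / (m : ℝ)) * ∑ i, η i)
    (B₁ B₂ U : ℝ → ℝ)
    (hB₁ : ∀ x, B₁ x = (1 / 2) * Real.sqrt (x + τ * (1 - x)))
    (hB₂ : ∀ x, B₂ x = Real.exp (-x) * (x + (Real.sqrt τ / 2) * Real.sqrt (1 - x)))
    (hU : ∀ x, U x = min (B₁ x) (B₂ x)) :
    ∑ i, U (η i) ≤ (m : ℝ) * U ηbar := by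
  have hm0 : (0 : ℝ) < m := by exact_mod_cast hm
  have hsqrt : Real.sqrt τ ≤ 1 := Real.sqrt_le_one.2 hτ1.le
  have hconc : ConcaveOn ℝ (Set.Icc 0 1) U := by
    have h₁ := concaveOn_half_mul_sqrt hτ0.le
    have h₂ := concaveOn_exp_neg_mul_add_sqrt (c := Real.sqrt τ / 2) (by positivity) (by linarith)
    rw [← funext hB₁] at h₁
    rw [← funext hB₂] at h₂
    rw [funext hU]
    exact h₁.inf h₂
  have hJ := hconc.le_map_sum (t := Finset.univ) (w := fun _ => 1 / (m : ℝ)) (p := η)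
    (fun _ _ => by positivity) (by simp [hm0.ne']) (fun i _ => hη i)
  simp only [smul_eq_mul, ← Finset.mul_sum] at hJ
  rw [← hηbar, one_div, inv_mul_le_iff₀ hm0] at hJ
  exact hJ
end
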